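/- Let ζ° lie on a wall L, C the unique θ_{ζ°}-stable A-module with ζ°·dim C = 0, and ζ^± in the adjacent chambers. (1) For a ζ°-stable framed module Ṽ and a point of the Grassmannian Gr(k, Ext¹_Ã(C, Ṽ)), the framed module Ṽ' defined by the corresponding universal extension 0 → Ṽ → Ṽ' → C^{⊕k} → 0 is ζ^+-stable. (2) For a point of Gr(k, Ext¹_Ã(Ṽ, C)), the module Ṽ'' defined by the corresponding universal extension 0 → C^{⊕k} → Ṽ'' → Ṽ → 0 is ζ^--stable. -/

import Mathlib

open Module

/-- A finite-dimensional representation of the framed conifold quiver: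
vector spaces `V0`, `V1` at the two vertices of the conifold quiver `Q`
(arrows `a1 a2 : 0 → 1`, `b1 b2 : 1 → 0`, relations coming from the
superpotential `ω = a1b1a2b2 − a1b2a2b1`), and a framing space `Vf` at the
vertex `∞` with the framing arrow `w : ∞ → 0`.  An unframed `A`-module is
a `QRep` with `Vf = 0`; a framed module `Ṽ` with `dim V∞ = 1` is a `QRep`
with `dim Vf = 1`. -/
structure QRep : Type 1 where
  V0 : Type
  V1 : Type
  Vf : Type
  [acg0 : AddCommGroup V0]
  [acg1 : AddCommGroup V1]
  [acgf : AddCommGroup Vf]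
  [mod0 : Module ℂ V0]
  [mod1 : Module ℂ V1]
  [modf : Module ℂ Vf]
  [fin0 : FiniteDimensional ℂ V0]
  [fin1 : FiniteDimensional ℂ V1]
  [finf : FiniteDimensional ℂ Vf]
  a1 : V0 →ₗ[ℂ] V1
  a2 : V0 →ₗ[ℂ] V1
  b1 : V1 →ₗ[ℂ] V0
  b2 : V1 →ₗ[ℂ] V0
  w : Vf →ₗ[ℂ] V0
  rel1 : a1 ∘ₗ (b1 ∘ₗ a2) = a2 ∘ₗ (b1 ∘ₗ a1)
  rel2 : a1 ∘ₗ (b2 ∘ₗ a2) = a2 ∘ₗ (b2 ∘ₗ a1)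
  rel3 : b1 ∘ₗ (a1 ∘ₗ b2) = b2 ∘ₗ (a1 ∘ₗ b1)
  rel4 : b1 ∘ₗ (a2 ∘ₗ b2) = b2 ∘ₗ (a2 ∘ₗ b1)

attribute [instance] QRep.acg0 QRep.acg1 QRep.acgf
attribute [instance] QRep.mod0 QRep.mod1 QRep.modf
attribute [instance] QRep.fin0 QRep.fin1 QRep.finf

noncomputable def QRep.d0 (V : QRep) : ℕ := finrank ℂ V.V0
noncomputable def QRep.d1 (V : QRep) : ℕ := finrank ℂ V.V1
noncomputable def QRep.df (V : QRep) : ℕ := finrank ℂ V.Vf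

/-- A submodule of a framed module. -/
structure QSub (V : QRep) : Type where
  S0 : Submodule ℂ V.V0
  S1 : Submodule ℂ V.V1
  Sf : Submodule ℂ V.Vf
  ha1 : ∀ x ∈ S0, V.a1 x ∈ S1
  ha2 : ∀ x ∈ S0, V.a2 x ∈ S1
  hb1 : ∀ y ∈ S1, V.b1 y ∈ S0
  hb2 : ∀ y ∈ S1, V.b2 y ∈ S0
  hw : ∀ z ∈ Sf, V.w z ∈ S0

def QSub.IsBot {V : QRep} (S : QSub V) : Prop := S.S0 = ⊥ ∧ S.S1 = ⊥ ∧ S.Sf = ⊥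
def QSub.IsTop {V : QRep} (S : QSub V) : Prop := S.S0 = ⊤ ∧ S.S1 = ⊤ ∧ S.Sf = ⊤

/-- The slope `θ_ζ̃` for a weight `ζ̃ = (ζ0, ζ1, ζ∞)`. -/
noncomputable def slopeQ (z : ℝ × ℝ × ℝ) (n0 n1 nf : ℕ) : ℝ :=
  (z.1 * n0 + z.2.1 * n1 + z.2.2 * nf) / (n0 + n1 + nf)

/-- `θ_ζ̃`-stability: every nonzero proper submodule has strictly smaller
slope. -/
def IsStableQ (z : ℝ × ℝ × ℝ) (V : QRep) : Prop :=
  ∀ S : QSub V, ¬ S.IsBot → ¬ S.IsTop →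
    slopeQ z (finrank ℂ S.S0) (finrank ℂ S.S1) (finrank ℂ S.Sf) <
      slopeQ z V.d0 V.d1 V.df

/-- `ζ`-stability of a framed module (`dim Vf = 1`): `θ`-stability for the
weight `(ζ0, ζ1, −ζ0·dim V0 − ζ1·dim V1)`. -/
noncomputable def IsStableFr (ζ : ℝ × ℝ) (V : QRep) : Prop :=
  IsStableQ (ζ.1, ζ.2, -(ζ.1 * V.d0 + ζ.2 * V.d1)) V

/-- `θ_ζ`-stability of an unframed module (`Vf = 0`). -/
def IsStableUn (ζ : ℝ × ℝ) (V : QRep) : Prop :=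
  IsStableQ (ζ.1, ζ.2, 0) V

/-- A morphism of framed modules. -/
structure QHom (V W : QRep) : Type where
  g0 : V.V0 →ₗ[ℂ] W.V0
  g1 : V.V1 →ₗ[ℂ] W.V1
  gf : V.Vf →ₗ[ℂ] W.Vf
  comm_a1 : g1 ∘ₗ V.a1 = W.a1 ∘ₗ g0
  comm_a2 : g1 ∘ₗ V.a2 = W.a2 ∘ₗ g0
  comm_b1 : g0 ∘ₗ V.b1 = W.b1 ∘ₗ g1
  comm_b2 : g0 ∘ₗ V.b2 = W.b2 ∘ₗ g1
  comm_w : g0 ∘ₗ V.w = W.w ∘ₗ gf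

/-- Isomorphism of framed modules. -/
def QIso (V W : QRep) : Prop :=
  ∃ f : QHom V W, Function.Bijective f.g0 ∧ Function.Bijective f.g1 ∧
    Function.Bijective f.gf

/-- A short exact sequence `0 → B → E → T → 0` of framed modules. -/
def IsExactSeq {B E T : QRep} (i : QHom B E) (p : QHom E T) : Prop :=
  Function.Injective i.g0 ∧ Function.Injective i.g1 ∧ Function.Injective i.gf ∧
  Function.Surjective p.g0 ∧ Function.Surjective p.g1 ∧ Function.Surjective p.gf ∧
  LinearMap.range i.g0 = LinearMap.ker p.g0 ∧
  LinearMap.range i.g1 = LinearMap.ker p.g1 ∧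
  LinearMap.range i.gf = LinearMap.ker p.gf

/-- The space of Ext¹-cochains for the pair `(T, B)`: an extension
`0 → B → E → T → 0` is described, after a choice of splitting of the
underlying vector spaces, by one block `T → B` for each arrow. -/
abbrev ExtCochain (T B : QRep) : Type :=
  (T.V0 →ₗ[ℂ] B.V1) × (T.V0 →ₗ[ℂ] B.V1) × (T.V1 →ₗ[ℂ] B.V0) ×
  (T.V1 →ₗ[ℂ] B.V0) × (T.Vf →ₗ[ℂ] B.V0)

/-- The cocycle condition: the block-upper-triangular maps on `B ⊕ T`
determined by `ξ` satisfy the relations of the framed conifold algebra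
`Ã` (the linearizations of the four superpotential relations; there is no
relation involving the framing arrow). -/
def IsECocycle (T B : QRep) (ξ : ExtCochain T B) : Prop :=
  (B.b2 ∘ₗ (B.a2 ∘ₗ ξ.2.2.1) + B.b2 ∘ₗ (ξ.2.1 ∘ₗ T.b1) + ξ.2.2.2.1 ∘ₗ (T.a2 ∘ₗ T.b1) =
    B.b1 ∘ₗ (B.a2 ∘ₗ ξ.2.2.2.1) + B.b1 ∘ₗ (ξ.2.1 ∘ₗ T.b2) + ξ.2.2.1 ∘ₗ (T.a2 ∘ₗ T.b2)) ∧
  (B.b1 ∘ₗ (B.a1 ∘ₗ ξ.2.2.2.1) + B.b1 ∘ₗ (ξ.1 ∘ₗ T.b2) + ξ.2.2.1 ∘ₗ (T.a1 ∘ₗ T.b2) =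
    B.b2 ∘ₗ (B.a1 ∘ₗ ξ.2.2.1) + B.b2 ∘ₗ (ξ.1 ∘ₗ T.b1) + ξ.2.2.2.1 ∘ₗ (T.a1 ∘ₗ T.b1)) ∧
  (B.a1 ∘ₗ (B.b2 ∘ₗ ξ.2.1) + B.a1 ∘ₗ (ξ.2.2.2.1 ∘ₗ T.a2) + ξ.1 ∘ₗ (T.b2 ∘ₗ T.a2) =
    B.a2 ∘ₗ (B.b2 ∘ₗ ξ.1) + B.a2 ∘ₗ (ξ.2.2.2.1 ∘ₗ T.a1) + ξ.2.1 ∘ₗ (T.b2 ∘ₗ T.a1)) ∧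
  (B.a2 ∘ₗ (B.b1 ∘ₗ ξ.1) + B.a2 ∘ₗ (ξ.2.2.1 ∘ₗ T.a1) + ξ.2.1 ∘ₗ (T.b1 ∘ₗ T.a1) =
    B.a1 ∘ₗ (B.b1 ∘ₗ ξ.2.1) + B.a1 ∘ₗ (ξ.2.2.1 ∘ₗ T.a2) + ξ.1 ∘ₗ (T.b1 ∘ₗ T.a2))

/-- Coboundaries: the cochains describing the trivial (split) extension. -/
def IsECoboundary (T B : QRep) (ξ : ExtCochain T B) : Prop :=
  ∃ (η0 : T.V0 →ₗ[ℂ] B.V0) (η1 : T.V1 →ₗ[ℂ] B.V1) (ηf : T.Vf →ₗ[ℂ] B.Vf),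
    ξ.1 = B.a1 ∘ₗ η0 - η1 ∘ₗ T.a1 ∧
    ξ.2.1 = B.a2 ∘ₗ η0 - η1 ∘ₗ T.a2 ∧
    ξ.2.2.1 = B.b1 ∘ₗ η1 - η0 ∘ₗ T.b1 ∧
    ξ.2.2.2.1 = B.b2 ∘ₗ η1 - η0 ∘ₗ T.b2 ∧
    ξ.2.2.2.2 = B.w ∘ₗ ηf - η0 ∘ₗ T.w

/-- `n = dim_ℂ Ext¹_Ã(T, B)` (extensions `0 → B → E → T → 0` in the
category of `Ã`-modules), characterized by the existence of a family of
cocycles whose classes form a basis of cocycles modulo coboundaries. -/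
def IsExt1Dim (T B : QRep) (n : ℕ) : Prop :=
  ∃ ξ : Fin n → ExtCochain T B,
    (∀ i, IsECocycle T B (ξ i)) ∧
    (∀ c : Fin n → ℂ, IsECoboundary T B (∑ i, c i • ξ i) → c = 0) ∧
    (∀ ζ : ExtCochain T B, IsECocycle T B ζ →
      ∃ c : Fin n → ℂ, IsECoboundary T B (ζ - ∑ i, c i • ξ i))



/-- `ζ` lies on one of the walls `L^∓_+(m)` (`m ≥ 1`) or `L^∓_-(m)`
(`m ≥ 0`). -/
def OnWall (ζ : ℝ × ℝ) (m : ℕ) : Prop :=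
  (1 ≤ m ∧ ζ.1 < ζ.2 ∧ (m : ℝ) * ζ.1 + ((m : ℝ) - 1) * ζ.2 = 0) ∨
  (ζ.1 < ζ.2 ∧ (m : ℝ) * ζ.1 + ((m : ℝ) + 1) * ζ.2 = 0) ∨
  (1 ≤ m ∧ ζ.2 < ζ.1 ∧ (m : ℝ) * ζ.1 + ((m : ℝ) - 1) * ζ.2 = 0) ∨
  (ζ.2 < ζ.1 ∧ (m : ℝ) * ζ.1 + ((m : ℝ) + 1) * ζ.2 = 0)

/-- Componentwise application of a linear map to `k`-tuples. -/
def pmap {A B : Type} [AddCommGroup A] [AddCommGroup B] [Module ℂ A]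
    [Module ℂ B] (k : ℕ) (f : A →ₗ[ℂ] B) : (Fin k → A) →ₗ[ℂ] (Fin k → B) :=
  LinearMap.pi (fun i => f ∘ₗ LinearMap.proj i)

/-- The direct sum `C^{⊕k}` of `k` copies of a framed module. -/
def QRep.pow (C : QRep) (k : ℕ) : QRep where
  V0 := Fin k → C.V0
  V1 := Fin k → C.V1
  Vf := Fin k → C.Vf
  a1 := pmap k C.a1
  a2 := pmap k C.a2
  b1 := pmap k C.b1
  b2 := pmap k C.b2
  w := pmap k C.w
  rel1 := LinearMap.ext fun x => funext fun i =>
    LinearMap.congr_fun C.rel1 (x i)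
  rel2 := LinearMap.ext fun x => funext fun i =>
    LinearMap.congr_fun C.rel2 (x i)
  rel3 := LinearMap.ext fun x => funext fun i =>
    LinearMap.congr_fun C.rel3 (x i)
  rel4 := LinearMap.ext fun x => funext fun i =>
    LinearMap.congr_fun C.rel4 (x i)

/-- Assembling `k` cochains for the pair `(C, B)` into a cochain for
`(C^{⊕k}, B)`: describes extensions `0 → B → E → C^{⊕k} → 0`. -/
noncomputable def assembleRow {C B : QRep} {k : ℕ}
    (ξ : Fin k → ExtCochain C B) : ExtCochain (C.pow k) B :=
  (∑ j, (ξ j).1 ∘ₗ LinearMap.proj j,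
   ∑ j, (ξ j).2.1 ∘ₗ LinearMap.proj j,
   ∑ j, (ξ j).2.2.1 ∘ₗ LinearMap.proj j,
   ∑ j, (ξ j).2.2.2.1 ∘ₗ LinearMap.proj j,
   ∑ j, (ξ j).2.2.2.2 ∘ₗ LinearMap.proj j)

/-- Assembling `k` cochains for the pair `(T, C)` into a cochain for
`(T, C^{⊕k})`: describes extensions `0 → C^{⊕k} → E → T → 0`. -/
noncomputable def assembleCol {T C : QRep} {k : ℕ}
    (ξ : Fin k → ExtCochain T C) : ExtCochain T (C.pow k) :=
  (LinearMap.pi (fun j => (ξ j).1),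
   LinearMap.pi (fun j => (ξ j).2.1),
   LinearMap.pi (fun j => (ξ j).2.2.1),
   LinearMap.pi (fun j => (ξ j).2.2.2.1),
   LinearMap.pi (fun j => (ξ j).2.2.2.2))

/-- The exact sequence `0 → B → E → T → 0` given by `(i, p)` realizes the
extension class of the cochain `ξ`: there are vector space splittings of
`p` with respect to which the arrows of `E` are block upper triangular
with off-diagonal blocks `ξ`. -/
def RealizesExt {B E T : QRep} (i : QHom B E) (p : QHom E T)
    (ξ : ExtCochain T B) : Prop :=
  IsExactSeq i p ∧
  ∃ (s0 : T.V0 →ₗ[ℂ] E.V0) (s1 : T.V1 →ₗ[ℂ] E.V1) (sf : T.Vf →ₗ[ℂ] E.Vf),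
    p.g0 ∘ₗ s0 = LinearMap.id ∧ p.g1 ∘ₗ s1 = LinearMap.id ∧
    p.gf ∘ₗ sf = LinearMap.id ∧
    i.g1 ∘ₗ ξ.1 = E.a1 ∘ₗ s0 - s1 ∘ₗ T.a1 ∧
    i.g1 ∘ₗ ξ.2.1 = E.a2 ∘ₗ s0 - s1 ∘ₗ T.a2 ∧
    i.g0 ∘ₗ ξ.2.2.1 = E.b1 ∘ₗ s1 - s0 ∘ₗ T.b1 ∧
    i.g0 ∘ₗ ξ.2.2.2.1 = E.b2 ∘ₗ s1 - s0 ∘ₗ T.b2 ∧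
    i.g0 ∘ₗ ξ.2.2.2.2 = E.w ∘ₗ sf - s0 ∘ₗ T.w



section LinearAlgebra

variable {k : ℕ} {A B W X : Type} [AddCommGroup A] [AddCommGroup B] [AddCommGroup W]
  [AddCommGroup X] [Module ℂ A] [Module ℂ B] [Module ℂ W] [Module ℂ X]

/-- The map `c ↦ μ ⊗ c` into `k`-tuples. -/
def tens (μ : Fin k → ℂ) : A →ₗ[ℂ] (Fin k → A) :=
  LinearMap.pi fun j => μ j • LinearMap.id

/-- The linear combination of the coordinates with coefficients `μ`. -/
def lincomb (μ : Fin k → ℂ) : (Fin k → A) →ₗ[ℂ] A :=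
  ∑ j, μ j • LinearMap.proj j

/-- The action of an endomorphism of `ℂ^k` on `k`-tuples. -/
def tupleAct (L : (Fin k → ℂ) →ₗ[ℂ] (Fin k → ℂ)) : (Fin k → A) →ₗ[ℂ] (Fin k → A) :=
  LinearMap.pi fun i => lincomb fun j => L (Pi.single j 1) i

theorem tens_apply (μ : Fin k → ℂ) (c : A) (j : Fin k) : tens μ c j = μ j • c := rfl

theorem lincomb_apply (μ : Fin k → ℂ) (x : Fin k → A) : lincomb μ x = ∑ j, μ j • x j := by
  simp [lincomb]

theorem lincomb_single (j : Fin k) (x : Fin k → A) :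
    lincomb (Pi.single j 1) x = x j := by
  simp [lincomb_apply, Pi.single_apply]

theorem lincomb_sub_smul (i j : Fin k) (l : ℂ) (x : Fin k → A) :
    lincomb (Pi.single i 1 - l • Pi.single j 1) x = x i - l • x j := by
  simp [lincomb_apply, Pi.single_apply, sub_smul, Finset.sum_sub_distrib]

theorem lincomb_pmap (μ : Fin k → ℂ) (f : A →ₗ[ℂ] B) :
    lincomb μ ∘ₗ pmap k f = f ∘ₗ lincomb μ := by
  ext x
  simp [lincomb_apply, pmap]

theorem tens_map (μ : Fin k → ℂ) (f : A →ₗ[ℂ] B) (c : A) :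
    pmap k f (tens μ c) = tens μ (f c) := by
  ext j
  simp [tens_apply, pmap]

theorem tupleAct_apply (L : (Fin k → ℂ) →ₗ[ℂ] (Fin k → ℂ)) (x : Fin k → A) (i : Fin k) :
    tupleAct L x i = lincomb (fun j => L (Pi.single j 1) i) x := rfl

theorem tupleAct_eq_sum (L : (Fin k → ℂ) →ₗ[ℂ] (Fin k → ℂ)) (x : Fin k → A) :
    tupleAct L x = ∑ j, tens (L (Pi.single j 1)) (x j) := by
  ext i
  simp [tupleAct_apply, lincomb_apply, tens_apply]

theorem tupleAct_pmap (L : (Fin k → ℂ) →ₗ[ℂ] (Fin k → ℂ)) (f : A →ₗ[ℂ] B) :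
    tupleAct L ∘ₗ pmap k f = pmap k f ∘ₗ tupleAct L := by
  refine LinearMap.ext fun x => funext fun i => ?_
  exact LinearMap.congr_fun (lincomb_pmap (fun j => L (Pi.single j 1) i) f) x

theorem tupleAct_tens (L : (Fin k → ℂ) →ₗ[ℂ] (Fin k → ℂ)) (μ : Fin k → ℂ) (c : A) :
    tupleAct L (tens μ c) = tens (L μ) c := by
  ext i
  have h : L μ = ∑ j, μ j • L (Pi.single j 1) := by
    conv_lhs => rw [pi_eq_sum_univ' μ]
    simp [map_sum]
  rw [h]
  simp [tupleAct_apply, lincomb_apply, tens_apply, Finset.sum_smul, smul_smul, mul_comm]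

theorem sub_tupleAct (L : (Fin k → ℂ) →ₗ[ℂ] (Fin k → ℂ)) (x : Fin k → A) :
    x - tupleAct L x = ∑ j, tens (Pi.single j 1 - L (Pi.single j 1)) (x j) := by
  ext i
  simp [tupleAct_eq_sum, tens_apply, sub_smul, Finset.sum_sub_distrib, Pi.single_apply]

theorem tupleAct_idem {L : (Fin k → ℂ) →ₗ[ℂ] (Fin k → ℂ)} (hL : ∀ μ, L (L μ) = L μ)
    (x : Fin k → A) : tupleAct L (tupleAct L x) = tupleAct L x := by
  simp [tupleAct_eq_sum L x, tupleAct_tens, hL]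

theorem eq_zero_of_tens_eq_zero {μ : Fin k → ℂ} (hμ : μ ≠ 0) {c : A} (h : tens μ c = 0) :
    c = 0 := by
  obtain ⟨j, hj⟩ := Function.ne_iff.mp hμ
  exact (smul_eq_zero.mp (congrFun h j)).resolve_left hj

theorem Submodule.finrank_inf_ker_add_map [FiniteDimensional ℂ A] (S : Submodule ℂ A)
    (g : A →ₗ[ℂ] B) :
    finrank ℂ (S ⊓ LinearMap.ker g : Submodule ℂ A) + finrank ℂ (S.map g) = finrank ℂ S := by
  have h := (g.domRestrict S).finrank_range_add_finrank_ker
  rw [LinearMap.range_domRestrict, LinearMap.ker_domRestrict] at h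
  have h2 := Submodule.finrank_map_subtype_eq S ((LinearMap.ker g).comap S.subtype)
  rw [Submodule.map_comap_subtype] at h2
  rw [h2, add_comm]
  exact h

theorem Submodule.finrank_comap_add_map [FiniteDimensional ℂ A] {i : W →ₗ[ℂ] A}
    {p : A →ₗ[ℂ] B} (hi : Function.Injective i) (hip : LinearMap.range i = LinearMap.ker p)
    (S : Submodule ℂ A) :
    finrank ℂ (S.comap i) + finrank ℂ (S.map p) = finrank ℂ S := by
  rw [← S.finrank_inf_ker_add_map p, ← hip, inf_comm, ← Submodule.map_comap_eq,
    (Submodule.equivMapOfInjective i hi (S.comap i)).finrank_eq]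

/-- Two linear maps, one of them an isomorphism on `T`, are proportional at some nonzero
vector of `T`. -/
theorem exists_proportional_vector [FiniteDimensional ℂ A] {T : Submodule ℂ A} (hT : T ≠ ⊥)
    (f g : A →ₗ[ℂ] B) (hg : T ⊓ LinearMap.ker g = ⊥) (hs : T.map g = ⊤) :
    ∃ l : ℂ, ∃ x ∈ T, x ≠ 0 ∧ f x - l • g x = 0 := by
  have hbij : Function.Bijective (g.domRestrict T) := by
    constructor
    · refine (injective_iff_map_eq_zero _).mpr fun x hx => Subtype.ext ?_
      have : (x : A) ∈ T ⊓ LinearMap.ker g := ⟨x.2, hx⟩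
      rwa [hg] at this
    · rw [← LinearMap.range_eq_top, LinearMap.range_domRestrict, hs]
  let e := LinearEquiv.ofBijective (g.domRestrict T) hbij
  have : Nontrivial T := Submodule.nontrivial_iff_ne_bot.mpr hT
  obtain ⟨l, hl⟩ := Module.End.exists_eigenvalue
    ((e.symm : B →ₗ[ℂ] T) ∘ₗ f.domRestrict T)
  obtain ⟨x, hx⟩ := hl.exists_hasEigenvector
  refine ⟨l, x, x.2, fun h => hx.2 (Subtype.ext h), ?_⟩
  have h := congrArg e hx.apply_eq_smul
  simp only [LinearMap.comp_apply, LinearEquiv.coe_coe, LinearEquiv.apply_symm_apply,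
    map_smul] at h
  exact sub_eq_zero.mpr h

theorem exists_lift_mem (S : Submodule ℂ A) (p : A →ₗ[ℂ] B) (l : W →ₗ[ℂ] B)
    (h : ∀ c, l c ∈ S.map p) : ∃ r : W →ₗ[ℂ] A, (∀ c, r c ∈ S) ∧ ∀ c, p (r c) = l c := by
  obtain ⟨r, hr⟩ := Module.projective_lifting_property (p.submoduleMap S)
    (l.codRestrict (S.map p) h) (p.submoduleMap_surjective S)
  exact ⟨S.subtype ∘ₗ r, fun c => (r c).2,
    fun c => congrArg Subtype.val (LinearMap.congr_fun hr c)⟩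

theorem exists_factor {i : A →ₗ[ℂ] B} {p : B →ₗ[ℂ] X}
    (hip : LinearMap.range i = LinearMap.ker p) (l : W →ₗ[ℂ] B) (h : ∀ c, p (l c) = 0) :
    ∃ r : W →ₗ[ℂ] A, ∀ c, i (r c) = l c := by
  obtain ⟨r, -, hr⟩ := exists_lift_mem ⊤ i l fun c => by
    rw [Submodule.map_top, hip]
    exact h c
  exact ⟨r, hr⟩

end LinearAlgebra

section Submodules

variable {E T : QRep}

/-- The weight of a submodule. -/
noncomputable def QSub.wt (a b c : ℝ) (S : QSub E) : ℝ :=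
  a * finrank ℂ S.S0 + b * finrank ℂ S.S1 + c * finrank ℂ S.Sf

/-- The elements of `S` killed by `g`. -/
def QSub.kerOn (S : QSub E) (g : QHom E T) : QSub E where
  S0 := S.S0 ⊓ LinearMap.ker g.g0
  S1 := S.S1 ⊓ LinearMap.ker g.g1
  Sf := S.Sf ⊓ LinearMap.ker g.gf
  ha1 x hx := ⟨S.ha1 x hx.1, by
    have h := LinearMap.congr_fun g.comm_a1 x
    have h0 : g.g0 x = 0 := hx.2
    simpa [h0] using h⟩
  ha2 x hx := ⟨S.ha2 x hx.1, by
    have h := LinearMap.congr_fun g.comm_a2 x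
    have h0 : g.g0 x = 0 := hx.2
    simpa [h0] using h⟩
  hb1 x hx := ⟨S.hb1 x hx.1, by
    have h := LinearMap.congr_fun g.comm_b1 x
    have h0 : g.g1 x = 0 := hx.2
    simpa [h0] using h⟩
  hb2 x hx := ⟨S.hb2 x hx.1, by
    have h := LinearMap.congr_fun g.comm_b2 x
    have h0 : g.g1 x = 0 := hx.2
    simpa [h0] using h⟩
  hw x hx := ⟨S.hw x hx.1, by
    have h := LinearMap.congr_fun g.comm_w x
    have h0 : g.gf x = 0 := hx.2
    simpa [h0] using h⟩

/-- The image of a submodule. -/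
def QSub.map (S : QSub E) (g : QHom E T) : QSub T where
  S0 := S.S0.map g.g0
  S1 := S.S1.map g.g1
  Sf := S.Sf.map g.gf
  ha1 := by
    rintro _ ⟨x, hx, rfl⟩
    exact ⟨_, S.ha1 x hx, LinearMap.congr_fun g.comm_a1 x⟩
  ha2 := by
    rintro _ ⟨x, hx, rfl⟩
    exact ⟨_, S.ha2 x hx, LinearMap.congr_fun g.comm_a2 x⟩
  hb1 := by
    rintro _ ⟨x, hx, rfl⟩
    exact ⟨_, S.hb1 x hx, LinearMap.congr_fun g.comm_b1 x⟩
  hb2 := by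
    rintro _ ⟨x, hx, rfl⟩
    exact ⟨_, S.hb2 x hx, LinearMap.congr_fun g.comm_b2 x⟩
  hw := by
    rintro _ ⟨x, hx, rfl⟩
    exact ⟨_, S.hw x hx, LinearMap.congr_fun g.comm_w x⟩

/-- The preimage of a submodule. -/
def QSub.comap (S : QSub T) (g : QHom E T) : QSub E where
  S0 := S.S0.comap g.g0
  S1 := S.S1.comap g.g1
  Sf := S.Sf.comap g.gf
  ha1 x hx := by
    have h := S.ha1 _ hx
    rwa [← LinearMap.comp_apply, ← g.comm_a1] at h
  ha2 x hx := by
    have h := S.ha2 _ hx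
    rwa [← LinearMap.comp_apply, ← g.comm_a2] at h
  hb1 x hx := by
    have h := S.hb1 _ hx
    rwa [← LinearMap.comp_apply, ← g.comm_b1] at h
  hb2 x hx := by
    have h := S.hb2 _ hx
    rwa [← LinearMap.comp_apply, ← g.comm_b2] at h
  hw x hx := by
    have h := S.hw _ hx
    rwa [← LinearMap.comp_apply, ← g.comm_w] at h

theorem QSub.wt_kerOn_add_map (a b c : ℝ) (S : QSub E) (g : QHom E T) :
    (S.kerOn g).wt a b c + (S.map g).wt a b c = S.wt a b c := by
  have h0 : finrank ℂ (S.kerOn g).S0 + finrank ℂ (S.map g).S0 = finrank ℂ S.S0 :=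
    S.S0.finrank_inf_ker_add_map g.g0
  have h1 : finrank ℂ (S.kerOn g).S1 + finrank ℂ (S.map g).S1 = finrank ℂ S.S1 :=
    S.S1.finrank_inf_ker_add_map g.g1
  have hf : finrank ℂ (S.kerOn g).Sf + finrank ℂ (S.map g).Sf = finrank ℂ S.Sf :=
    S.Sf.finrank_inf_ker_add_map g.gf
  simp only [wt, ← h0, ← h1, ← hf]
  push_cast
  ring

theorem IsExactSeq.finrank_sub {B E T : QRep} {i : QHom B E} {p : QHom E T}
    (h : IsExactSeq i p) (S : QSub E) :
    finrank ℂ (S.comap i).S0 + finrank ℂ (S.map p).S0 = finrank ℂ S.S0 ∧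
    finrank ℂ (S.comap i).S1 + finrank ℂ (S.map p).S1 = finrank ℂ S.S1 ∧
    finrank ℂ (S.comap i).Sf + finrank ℂ (S.map p).Sf = finrank ℂ S.Sf := by
  obtain ⟨h0, h1, hf, -, -, -, e0, e1, ef⟩ := h
  exact ⟨S.S0.finrank_comap_add_map h0 e0, S.S1.finrank_comap_add_map h1 e1,
    S.Sf.finrank_comap_add_map hf ef⟩

theorem QSub.wt_comap_add_map {V : QRep} (a b c : ℝ) (S : QSub E) {i : QHom V E}
    {p : QHom E T} (h : IsExactSeq i p) :
    (S.comap i).wt a b c + (S.map p).wt a b c = S.wt a b c := by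
  obtain ⟨r0, r1, rf⟩ := h.finrank_sub S
  simp only [wt, ← r0, ← r1, ← rf]
  push_cast
  ring

theorem QSub.IsBot.wt_eq_zero {S : QSub E} (h : S.IsBot) (a b c : ℝ) : S.wt a b c = 0 := by
  obtain ⟨h0, h1, hf⟩ := h
  rw [wt, h0, h1, hf]
  simp

theorem QSub.IsTop.wt_eq {S : QSub E} (h : S.IsTop) (a b c : ℝ) :
    S.wt a b c = a * E.d0 + b * E.d1 + c * E.df := by
  obtain ⟨h0, h1, hf⟩ := h
  rw [wt, h0, h1, hf]
  simp [QRep.d0, QRep.d1, QRep.df]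

theorem QSub.finrank_pos_of_not_isBot {S : QSub E} (h : ¬ S.IsBot) :
    0 < finrank ℂ S.S0 + finrank ℂ S.S1 + finrank ℂ S.Sf := by
  by_contra hc
  exact h ⟨Submodule.finrank_eq_zero.mp (by omega), Submodule.finrank_eq_zero.mp (by omega),
    Submodule.finrank_eq_zero.mp (by omega)⟩

/-- When the weight of the whole module vanishes, stability says that proper nonzero
submodules have negative weight. -/
theorem isStableQ_iff {z : ℝ × ℝ × ℝ} {V : QRep}
    (hz : z.1 * V.d0 + z.2.1 * V.d1 + z.2.2 * V.df = 0) :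
    IsStableQ z V ↔ ∀ S : QSub V, ¬ S.IsBot → ¬ S.IsTop → S.wt z.1 z.2.1 z.2.2 < 0 := by
  unfold IsStableQ
  refine forall_congr' fun S => forall_congr' fun hb => forall_congr' fun _ => ?_
  have hpos : (0 : ℝ) < finrank ℂ S.S0 + finrank ℂ S.S1 + finrank ℂ S.Sf := by
    exact_mod_cast QSub.finrank_pos_of_not_isBot hb
  rw [slopeQ, slopeQ, hz, zero_div, div_lt_iff₀ hpos, zero_mul]
  rfl

theorem isStableFr_iff {ζ : ℝ × ℝ} {V : QRep} (hf : V.df = 1) :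
    IsStableFr ζ V ↔ ∀ S : QSub V, ¬ S.IsBot → ¬ S.IsTop →
      S.wt ζ.1 ζ.2 (-(ζ.1 * V.d0 + ζ.2 * V.d1)) < 0 :=
  isStableQ_iff (by simp [hf])

open Filter Topology in
/-- A lexicographic criterion for stability in the chamber on the `σ`-side of `ζ`. -/
theorem isStableFr_perturb {ζ : ℝ × ℝ} {V : QRep} (hf : V.df = 1) (σ : ℝ)
    (h : ∀ S : QSub V, ¬ S.IsBot → ¬ S.IsTop →
      S.wt ζ.1 ζ.2 (-(ζ.1 * V.d0 + ζ.2 * V.d1)) < 0 ∨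
      (S.wt ζ.1 ζ.2 (-(ζ.1 * V.d0 + ζ.2 * V.d1)) = 0 ∧
        S.wt σ σ (-(σ * V.d0 + σ * V.d1)) < 0)) :
    ∃ ε₀ > (0 : ℝ), ∀ ε : ℝ, 0 < ε → ε < ε₀ →
      IsStableFr (ζ.1 + ε * σ, ζ.2 + ε * σ) V := by
  let g : ℝ → ℝ → ℝ → ℝ → ℝ → ℝ := fun a b x y z =>
    a * x + b * y + -(a * V.d0 + b * V.d1) * z
  have key : ∀ᶠ ε in 𝓝[>] (0 : ℝ),
      ∀ n : Fin (V.d0 + 1) × Fin (V.d1 + 1) × Fin (V.df + 1),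
        g ζ.1 ζ.2 n.1 n.2.1 n.2.2 < 0 ∨
          (g ζ.1 ζ.2 n.1 n.2.1 n.2.2 = 0 ∧ g σ σ n.1 n.2.1 n.2.2 < 0) →
        g ζ.1 ζ.2 n.1 n.2.1 n.2.2 + ε * g σ σ n.1 n.2.1 n.2.2 < 0 := by
    refine eventually_all.mpr fun n => ?_
    by_cases hn : g ζ.1 ζ.2 n.1 n.2.1 n.2.2 < 0
    · have hc : Tendsto (fun ε : ℝ => g ζ.1 ζ.2 n.1 n.2.1 n.2.2 + ε * g σ σ n.1 n.2.1 n.2.2)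
          (𝓝[>] 0) (𝓝 (g ζ.1 ζ.2 n.1 n.2.1 n.2.2 + 0 * g σ σ n.1 n.2.1 n.2.2)) :=
        ((by fun_prop : Continuous fun ε : ℝ => g ζ.1 ζ.2 n.1 n.2.1 n.2.2 +
          ε * g σ σ n.1 n.2.1 n.2.2).tendsto 0).mono_left nhdsWithin_le_nhds
      filter_upwards [hc.eventually_lt_const (by simpa using hn)] with ε hε _ using hε
    · filter_upwards [self_mem_nhdsWithin] with ε hε hh
      obtain ⟨h0, h1⟩ := hh.resolve_left hn
      rw [h0, zero_add]
      exact mul_neg_of_pos_of_neg hε h1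
  obtain ⟨ε₀, hε₀, hsub⟩ := mem_nhdsGT_iff_exists_Ioo_subset.mp key
  refine ⟨ε₀, hε₀, fun ε h1 h2 => (isStableFr_iff hf).mpr fun S hb ht => ?_⟩
  have := hsub ⟨h1, h2⟩ (⟨finrank ℂ S.S0, Nat.lt_succ_of_le S.S0.finrank_le⟩,
    ⟨finrank ℂ S.S1, Nat.lt_succ_of_le S.S1.finrank_le⟩,
    ⟨finrank ℂ S.Sf, Nat.lt_succ_of_le S.Sf.finrank_le⟩) (h S hb ht)
  simp only [g] at this
  simp only [QSub.wt]
  linarith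

end Submodules

section Powers

variable {C : QRep} {k : ℕ}

/-- The morphism `C^{⊕k} → C` with coefficients `μ`. -/
def QRep.powLincomb (C : QRep) {k : ℕ} (μ : Fin k → ℂ) : QHom (C.pow k) C where
  g0 := lincomb (A := C.V0) μ
  g1 := lincomb (A := C.V1) μ
  gf := lincomb (A := C.Vf) μ
  comm_a1 := lincomb_pmap μ C.a1
  comm_a2 := lincomb_pmap μ C.a2
  comm_b1 := lincomb_pmap μ C.b1
  comm_b2 := lincomb_pmap μ C.b2
  comm_w := lincomb_pmap μ C.w

/-- The endomorphism of `C^{⊕k}` induced by an endomorphism of `ℂ^k`. -/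
def QRep.powAct (C : QRep) {k : ℕ} (L : (Fin k → ℂ) →ₗ[ℂ] (Fin k → ℂ)) :
    QHom (C.pow k) (C.pow k) where
  g0 := tupleAct (A := C.V0) L
  g1 := tupleAct (A := C.V1) L
  gf := tupleAct (A := C.Vf) L
  comm_a1 := tupleAct_pmap L C.a1
  comm_a2 := tupleAct_pmap L C.a2
  comm_b1 := tupleAct_pmap L C.b1
  comm_b2 := tupleAct_pmap L C.b2
  comm_w := tupleAct_pmap L C.w

theorem QSub.wt_eq_of_Vf {E : QRep} (hf : finrank ℂ E.Vf = 0) (a b c : ℝ) (S : QSub E) :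
    S.wt a b c = S.wt a b 0 := by
  have h : finrank ℂ S.Sf = 0 := Nat.le_zero.mp (hf ▸ S.Sf.finrank_le)
  simp [wt, h]

theorem QRep.finrank_pow_Vf (hf : finrank ℂ C.Vf = 0) : finrank ℂ (C.pow k).Vf = 0 := by
  have := finrank_zero_iff.mp hf
  exact finrank_zero_iff.mpr (Pi.instSubsingleton (β := fun _ : Fin k => C.Vf))

theorem QSub.Sf_eq_bot {E : QRep} (hf : finrank ℂ E.Vf = 0) (S : QSub E) : S.Sf = ⊥ :=
  Submodule.finrank_eq_zero.mp (Nat.le_zero.mp (hf ▸ S.Sf.finrank_le))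

theorem QSub.wt_nonpos {a b : ℝ} (hC : ∀ S : QSub C, S.IsBot ∨ S.IsTop ∨ S.wt a b 0 < 0)
    (h0 : a * C.d0 + b * C.d1 = 0) (S : QSub C) : S.wt a b 0 ≤ 0 := by
  rcases hC S with h | h | h
  · exact (h.wt_eq_zero a b 0).le
  · rw [h.wt_eq, h0]
    simp
  · exact h.le

/-- Powers of a stable module of slope zero are semistable. -/
theorem QSub.wt_pow_nonpos {a b : ℝ} (hf : finrank ℂ C.Vf = 0)
    (hC : ∀ S : QSub C, S.IsBot ∨ S.IsTop ∨ S.wt a b 0 < 0)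
    (h0 : a * C.d0 + b * C.d1 = 0) (S : QSub (C.pow k)) : S.wt a b 0 ≤ 0 := by
  suffices H : ∀ (J : Finset (Fin k)) (S : QSub (C.pow k)),
      (∀ x ∈ S.S0, ∀ j ∉ J, x j = 0) → (∀ x ∈ S.S1, ∀ j ∉ J, x j = 0) → S.wt a b 0 ≤ 0 from
    H Finset.univ S (by simp) (by simp)
  intro J
  induction J using Finset.induction_on with
  | empty =>
    intro S hS0 hS1
    refine (QSub.IsBot.wt_eq_zero (S := S) ⟨?_, ?_, S.Sf_eq_bot (C.finrank_pow_Vf hf)⟩ a b 0).le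
    · exact (Submodule.eq_bot_iff _).mpr fun x hx => funext fun j => hS0 x hx j (by simp)
    · exact (Submodule.eq_bot_iff _).mpr fun x hx => funext fun j => hS1 x hx j (by simp)
  | insert i J _ ih =>
    intro S hS0 hS1
    rw [← S.wt_kerOn_add_map a b 0 (C.powLincomb (Pi.single i 1))]
    refine add_nonpos (ih _ (fun x hx j hj => ?_) fun x hx j hj => ?_) (wt_nonpos hC h0 _)
    · by_cases hji : j = i
      · subst hji
        exact (lincomb_single (A := C.V0) j x).symm.trans hx.2
      · exact hS0 x hx.1 j (by simp [hji, hj])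
    · by_cases hji : j = i
      · subst hji
        exact (lincomb_single (A := C.V1) j x).symm.trans hx.2
      · exact hS1 x hx.1 j (by simp [hji, hj])

/-- A nonzero submodule of slope zero in `C^{⊕k}` contains a diagonally embedded copy of `C`. -/
theorem QSub.exists_tens_mem {a b : ℝ} (hf : finrank ℂ C.Vf = 0)
    (hC : ∀ S : QSub C, S.IsBot ∨ S.IsTop ∨ S.wt a b 0 < 0)
    (h0 : a * C.d0 + b * C.d1 = 0) (S : QSub (C.pow k)) (hS : ¬ S.IsBot)
    (hw : S.wt a b 0 = 0) :
    ∃ μ : Fin k → ℂ, μ ≠ 0 ∧ (∀ c : C.V0, tens μ c ∈ S.S0) ∧ ∀ c : C.V1, tens μ c ∈ S.S1 := by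
  induction hn : finrank ℂ S.S0 + finrank ℂ S.S1 using Nat.strong_induction_on generalizing S with
  | _ n ih =>
  have hsplit (μ : Fin k → ℂ) : (S.kerOn (C.powLincomb μ)).wt a b 0 = 0 ∧
      (S.map (C.powLincomb μ)).wt a b 0 = 0 := by
    have h1 := S.wt_kerOn_add_map a b 0 (C.powLincomb μ)
    have h2 := wt_pow_nonpos hf hC h0 (S.kerOn (C.powLincomb μ))
    have h3 := wt_nonpos hC h0 (S.map (C.powLincomb μ))
    constructor <;> linarith
  have hbot (T : QSub (C.pow k)) : T.IsBot ↔ T.S0 = ⊥ ∧ T.S1 = ⊥ :=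
    ⟨fun h => ⟨h.1, h.2.1⟩, fun h => ⟨h.1, h.2, T.Sf_eq_bot (C.finrank_pow_Vf hf)⟩⟩
  by_cases hmin : ∃ μ : Fin k → ℂ, ¬ (S.kerOn (C.powLincomb μ)).IsBot ∧
      ¬ ((S.kerOn (C.powLincomb μ)).S0 = S.S0 ∧ (S.kerOn (C.powLincomb μ)).S1 = S.S1)
  · obtain ⟨μ, hμ1, hμ2⟩ := hmin
    have le0 : (S.kerOn (C.powLincomb μ)).S0 ≤ S.S0 := inf_le_left
    have le1 : (S.kerOn (C.powLincomb μ)).S1 ≤ S.S1 := inf_le_left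
    have hlt : finrank ℂ (S.kerOn (C.powLincomb μ)).S0 +
        finrank ℂ (S.kerOn (C.powLincomb μ)).S1 < n := by
      have f0 := Submodule.finrank_mono le0
      have f1 := Submodule.finrank_mono le1
      by_contra hge
      exact hμ2 ⟨Submodule.eq_of_le_of_finrank_eq le0 (by omega),
        Submodule.eq_of_le_of_finrank_eq le1 (by omega)⟩
    obtain ⟨ν, hν, t0, t1⟩ := ih _ hlt _ hμ1 (hsplit μ).1 rfl
    exact ⟨ν, hν, fun c => le0 (t0 c), fun c => le1 (t1 c)⟩
  push Not at hmin
  have hvan (μ : Fin k → ℂ) (h : ¬ (S.kerOn (C.powLincomb μ)).IsBot) :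
      (∀ x ∈ S.S0, lincomb (A := C.V0) μ x = 0) ∧ ∀ x ∈ S.S1, lincomb (A := C.V1) μ x = 0 := by
    obtain ⟨e0, e1⟩ := hmin μ h
    exact ⟨fun x hx => (e0.ge hx).2, fun x hx => (e1.ge hx).2⟩
  obtain ⟨j, hj⟩ : ∃ j, (S.kerOn (C.powLincomb (Pi.single j 1))).IsBot := by
    by_contra! hc
    refine hS ((hbot S).mpr ⟨?_, ?_⟩)
    · exact (Submodule.eq_bot_iff _).mpr fun x hx => funext fun j =>
        (lincomb_single (A := C.V0) j x).symm.trans ((hvan _ (hc j)).1 x hx)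
    · exact (Submodule.eq_bot_iff _).mpr fun x hx => funext fun j =>
        (lincomb_single (A := C.V1) j x).symm.trans ((hvan _ (hc j)).2 x hx)
  have htop : (S.map (C.powLincomb (Pi.single j 1))).IsTop := by
    rcases hC (S.map (C.powLincomb (Pi.single j 1))) with h | h | h
    · refine absurd ((hbot S).mpr ⟨?_, ?_⟩) hS
      · exact eq_bot_iff.mpr (hj.1 ▸ le_inf le_rfl (LinearMap.le_ker_iff_map.mpr h.1))
      · exact eq_bot_iff.mpr (hj.2.1 ▸ le_inf le_rfl (LinearMap.le_ker_iff_map.mpr h.2.1))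
    · exact h
    · exact absurd (hsplit (Pi.single j 1)).2 h.ne
  have hprop (i : Fin k) : ∃ l : ℂ, (∀ x ∈ S.S0, x i = l • x j) ∧ ∀ x ∈ S.S1, x i = l • x j := by
    have hl : ∃ l : ℂ, ¬ (S.kerOn (C.powLincomb (Pi.single i 1 - l • Pi.single j 1))).IsBot := by
      by_cases hS0 : S.S0 = ⊥
      · have hS1 : S.S1 ≠ ⊥ := fun h => hS ((hbot S).mpr ⟨hS0, h⟩)
        obtain ⟨l, x, hx, hx0, hxl⟩ := exists_proportional_vector hS1
          (C.powLincomb (Pi.single i 1)).g1 (C.powLincomb (Pi.single j 1)).g1 hj.2.1 htop.2.1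
        refine ⟨l, fun h => hx0 ((Submodule.eq_bot_iff _).mp h.2.1 x ⟨hx, ?_⟩)⟩
        refine (lincomb_sub_smul (A := C.V1) i j l x).trans ?_
        rw [← lincomb_single (A := C.V1) i x, ← lincomb_single (A := C.V1) j x]
        exact hxl
      · obtain ⟨l, x, hx, hx0, hxl⟩ := exists_proportional_vector hS0
          (C.powLincomb (Pi.single i 1)).g0 (C.powLincomb (Pi.single j 1)).g0 hj.1 htop.1
        refine ⟨l, fun h => hx0 ((Submodule.eq_bot_iff _).mp h.1 x ⟨hx, ?_⟩)⟩
        refine (lincomb_sub_smul (A := C.V0) i j l x).trans ?_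
        rw [← lincomb_single (A := C.V0) i x, ← lincomb_single (A := C.V0) j x]
        exact hxl
    obtain ⟨l, hl⟩ := hl
    refine ⟨l, fun x hx => sub_eq_zero.mp ?_, fun x hx => sub_eq_zero.mp ?_⟩
    · exact (lincomb_sub_smul (A := C.V0) i j l x).symm.trans ((hvan _ hl).1 x hx)
    · exact (lincomb_sub_smul (A := C.V1) i j l x).symm.trans ((hvan _ hl).2 x hx)
  choose μ hμ0 hμ1 using hprop
  have ht0 (x) (hx : x ∈ S.S0) : x = tens (A := C.V0) μ (x j) := funext fun i => hμ0 i x hx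
  have ht1 (x) (hx : x ∈ S.S1) : x = tens (A := C.V1) μ (x j) := funext fun i => hμ1 i x hx
  refine ⟨μ, ?_, fun c => ?_, fun c => ?_⟩
  · rintro rfl
    refine hS ((hbot S).mpr ⟨?_, ?_⟩)
    · refine (Submodule.eq_bot_iff _).mpr fun x hx => (ht0 x hx).trans ?_
      exact funext fun i => zero_smul _ _
    · refine (Submodule.eq_bot_iff _).mpr fun x hx => (ht1 x hx).trans ?_
      exact funext fun i => zero_smul _ _
  · obtain ⟨x, hx, rfl⟩ : c ∈ S.S0.map (C.powLincomb (Pi.single j 1)).g0 :=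
      htop.1.ge Submodule.mem_top
    have he : (C.powLincomb (Pi.single j 1)).g0 x = x j := lincomb_single (A := C.V0) j x
    rw [he, ← ht0 x hx]
    exact hx
  · obtain ⟨x, hx, rfl⟩ : c ∈ S.S1.map (C.powLincomb (Pi.single j 1)).g1 :=
      htop.2.1.ge Submodule.mem_top
    have he : (C.powLincomb (Pi.single j 1)).g1 x = x j := lincomb_single (A := C.V1) j x
    rw [he, ← ht1 x hx]
    exact hx

/-- A proper submodule of slope zero in `C^{⊕k}` is killed by a nonzero linear combination
of the coordinates. -/
theorem QSub.exists_lincomb_eq_zero {a b : ℝ} (hf : finrank ℂ C.Vf = 0)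
    (hne : 0 < C.d0 + C.d1)
    (hC : ∀ S : QSub C, S.IsBot ∨ S.IsTop ∨ S.wt a b 0 < 0)
    (h0 : a * C.d0 + b * C.d1 = 0) (S : QSub (C.pow k)) (hS : ¬ S.IsTop)
    (hw : S.wt a b 0 = 0) :
    ∃ μ : Fin k → ℂ, μ ≠ 0 ∧ (∀ x ∈ S.S0, lincomb (A := C.V0) μ x = 0) ∧
      ∀ x ∈ S.S1, lincomb (A := C.V1) μ x = 0 := by
  let U : Submodule ℂ (Fin k → ℂ) :=
    (⨅ c : C.V0, S.S0.comap (LinearMap.pi fun j => (LinearMap.proj j).smulRight c)) ⊓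
      ⨅ c : C.V1, S.S1.comap (LinearMap.pi fun j => (LinearMap.proj j).smulRight c)
  have hU (μ) : μ ∈ U ↔ (∀ c : C.V0, tens μ c ∈ S.S0) ∧ ∀ c : C.V1, tens μ c ∈ S.S1 := by
    simp only [U, Submodule.mem_inf, Submodule.mem_iInf]
    rfl
  obtain ⟨Q, hQ⟩ := U.subtype.exists_leftInverse_of_injective U.ker_subtype
  let P : (Fin k → ℂ) →ₗ[ℂ] (Fin k → ℂ) := LinearMap.id - U.subtype ∘ₗ Q
  have hPU (μ) (h : μ ∈ U) : P μ = 0 := by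
    have : Q μ = ⟨μ, h⟩ := LinearMap.congr_fun hQ ⟨μ, h⟩
    simp [P, this]
  have hsub (μ) : μ - P μ ∈ U := by
    have : μ - P μ = Q μ := by simp [P]
    rw [this]
    exact (Q μ).2
  have hPP (μ) : P (P μ) = P μ := by
    have := hPU _ (hsub μ)
    rw [map_sub, sub_eq_zero] at this
    exact this.symm
  have sub0 (x : Fin k → C.V0) : x - tupleAct P x ∈ S.S0 := by
    rw [sub_tupleAct]
    exact Submodule.sum_mem S.S0 fun j _ => ((hU _).mp (hsub _)).1 (x j)
  have sub1 (x : Fin k → C.V1) : x - tupleAct P x ∈ S.S1 := by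
    rw [sub_tupleAct]
    exact Submodule.sum_mem S.S1 fun j _ => ((hU _).mp (hsub _)).2 (x j)
  have hbot : (S.map (C.powAct P)).IsBot := by
    by_contra hb
    have hw' : (S.map (C.powAct P)).wt a b 0 = 0 := by
      have h1 := S.wt_kerOn_add_map a b 0 (C.powAct P)
      have h2 := wt_pow_nonpos hf hC h0 (S.kerOn (C.powAct P))
      have h3 := wt_pow_nonpos hf hC h0 (S.map (C.powAct P))
      linarith
    obtain ⟨μ, hμ, t0, t1⟩ := exists_tens_mem hf hC h0 _ hb hw'
    have fix0 (y) (hy : y ∈ (S.map (C.powAct P)).S0) :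
        tupleAct (A := C.V0) P y = y ∧ y ∈ S.S0 := by
      obtain ⟨x, hx, rfl⟩ := hy
      refine ⟨tupleAct_idem (A := C.V0) hPP x, ?_⟩
      exact (Submodule.sub_mem_iff_right S.S0 hx).mp (sub0 x)
    have fix1 (y) (hy : y ∈ (S.map (C.powAct P)).S1) :
        tupleAct (A := C.V1) P y = y ∧ y ∈ S.S1 := by
      obtain ⟨x, hx, rfl⟩ := hy
      refine ⟨tupleAct_idem (A := C.V1) hPP x, ?_⟩
      exact (Submodule.sub_mem_iff_right S.S1 hx).mp (sub1 x)
    have hPμ := hPU μ ((hU μ).mpr ⟨fun c => (fix0 _ (t0 c)).2, fun c => (fix1 _ (t1 c)).2⟩)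
    have z0 (c : C.V0) : c = 0 := by
      refine eq_zero_of_tens_eq_zero hμ ((fix0 _ (t0 c)).1.symm.trans ?_)
      rw [tupleAct_tens, hPμ]
      exact funext fun i => zero_smul _ _
    have z1 (c : C.V1) : c = 0 := by
      refine eq_zero_of_tens_eq_zero hμ ((fix1 _ (t1 c)).1.symm.trans ?_)
      rw [tupleAct_tens, hPμ]
      exact funext fun i => zero_smul _ _
    have e0 : C.d0 = 0 := finrank_zero_iff_forall_zero.mpr z0
    have e1 : C.d1 = 0 := finrank_zero_iff_forall_zero.mpr z1
    omega
  have k0 (x) (hx : x ∈ S.S0) : tupleAct (A := C.V0) P x = 0 :=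
    (Submodule.eq_bot_iff _).mp hbot.1 _ ⟨x, hx, rfl⟩
  have k1 (x) (hx : x ∈ S.S1) : tupleAct (A := C.V1) P x = 0 :=
    (Submodule.eq_bot_iff _).mp hbot.2.1 _ ⟨x, hx, rfl⟩
  obtain ⟨i, hi⟩ : ∃ i, (fun j => P (Pi.single j 1) i) ≠ 0 := by
    by_contra! hc
    have hz0 (x : Fin k → C.V0) : tupleAct P x = 0 :=
      funext fun i => by rw [tupleAct_apply, hc]; simp [lincomb]
    have hz1 (x : Fin k → C.V1) : tupleAct P x = 0 :=
      funext fun i => by rw [tupleAct_apply, hc]; simp [lincomb]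
    refine hS ⟨Submodule.eq_top_iff'.mpr fun x => ?_, Submodule.eq_top_iff'.mpr fun x => ?_, ?_⟩
    · exact (Submodule.sub_mem_iff_left S.S0 ((hz0 x).symm ▸ S.S0.zero_mem)).mp (sub0 x)
    · exact (Submodule.sub_mem_iff_left S.S1 ((hz1 x).symm ▸ S.S1.zero_mem)).mp (sub1 x)
    · have := finrank_zero_iff.mp (C.finrank_pow_Vf (k := k) hf)
      exact Subsingleton.elim _ _
  exact ⟨_, hi, fun x hx => congrFun (k0 x hx) i, fun x hx => congrFun (k1 x hx) i⟩

end Powers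
section Extensions

variable {k : ℕ} {A B A' B' W X : Type} [AddCommGroup A] [AddCommGroup B] [AddCommGroup A']
  [AddCommGroup B'] [AddCommGroup W] [AddCommGroup X] [Module ℂ A] [Module ℂ B] [Module ℂ A']
  [Module ℂ B'] [Module ℂ W] [Module ℂ X]

/-- One block of the coboundary produced by a partial splitting `r`, `r'` over the diagonal copy
of `C` with coefficients `μ`: here `W`, `X` belong to `C`, `A`, `B` to the subobject and
`A'`, `B'` to the extension. -/
theorem sum_smul_eq_of_row_splitting {μ : Fin k → ℂ} {ξ : Fin k → W →ₗ[ℂ] B} {c : W →ₗ[ℂ] X}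
    {v : A →ₗ[ℂ] B} {e : A' →ₗ[ℂ] B'} {i : A →ₗ[ℂ] A'} {i' : B →ₗ[ℂ] B'}
    {s : (Fin k → W) →ₗ[ℂ] A'} {s' : (Fin k → X) →ₗ[ℂ] B'}
    {r : W →ₗ[ℂ] A'} {r' : X →ₗ[ℂ] B'} {η : W →ₗ[ℂ] A} {η' : X →ₗ[ℂ] B}
    (hi' : Function.Injective i') (hi : i' ∘ₗ v = e ∘ₗ i)
    (hξ : i' ∘ₗ (∑ j, ξ j ∘ₗ LinearMap.proj j) = e ∘ₗ s - s' ∘ₗ pmap k c)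
    (hr : ∀ x, r' (c x) = e (r x))
    (hη : ∀ x, i (η x) = s (tens μ x) - r x) (hη' : ∀ x, i' (η' x) = s' (tens μ x) - r' x) :
    ∑ j, μ j • ξ j = v ∘ₗ η - η' ∘ₗ c := by
  ext x
  apply hi'
  have h1 := LinearMap.congr_fun hξ (tens μ x)
  have h2 := LinearMap.congr_fun hi (η x)
  simp only [LinearMap.comp_apply, LinearMap.sub_apply, LinearMap.sum_apply,
    LinearMap.smul_apply, LinearMap.proj_apply, tens_apply, map_smul, tens_map, map_sub]
    at h1 h2 ⊢
  rw [h1, h2, hη, hη', hr, map_sub]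
  abel

/-- One block of the coboundary produced by sections `r`, `r'` of the extension that are
compatible up to the kernel of the linear combination with coefficients `μ`. -/
theorem sum_smul_eq_of_col_splitting {μ : Fin k → ℂ} {ξ : Fin k → W →ₗ[ℂ] B} {v : W →ₗ[ℂ] X}
    {c : A →ₗ[ℂ] B} {e : A' →ₗ[ℂ] B'} {i : (Fin k → A) →ₗ[ℂ] A'} {i' : (Fin k → B) →ₗ[ℂ] B'}
    {s r : W →ₗ[ℂ] A'} {s' r' : X →ₗ[ℂ] B'} {t : W →ₗ[ℂ] (Fin k → A)}
    {t' : X →ₗ[ℂ] (Fin k → B)}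
    (hi' : Function.Injective i') (hi : i' ∘ₗ pmap k c = e ∘ₗ i)
    (hξ : i' ∘ₗ LinearMap.pi ξ = e ∘ₗ s - s' ∘ₗ v)
    (ht : ∀ x, i (t x) = s x - r x) (ht' : ∀ x, i' (t' x) = s' x - r' x)
    (hr : ∀ x, ∃ y, i' y = e (r x) - r' (v x) ∧ lincomb μ y = 0) :
    ∑ j, μ j • ξ j = c ∘ₗ (lincomb μ ∘ₗ t) - (lincomb μ ∘ₗ t') ∘ₗ v := by
  ext x
  obtain ⟨y, hy, hy0⟩ := hr x
  have h1 : LinearMap.pi ξ x = pmap k c (t x) - t' (v x) + y := by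
    apply hi'
    have h1 := LinearMap.congr_fun hξ x
    have h2 := LinearMap.congr_fun hi (t x)
    simp only [LinearMap.comp_apply, LinearMap.sub_apply] at h1 h2
    rw [map_add, map_sub, h1, h2, ht, ht', hy, map_sub]
    abel
  have h2 := congrArg (lincomb μ) h1
  have h3 := LinearMap.congr_fun (lincomb_pmap μ c) (t x)
  simp only [LinearMap.comp_apply] at h3
  rw [map_add, map_sub, hy0, add_zero, h3, lincomb_apply] at h2
  simpa using h2

/-- A cochain is determined by its five blocks. -/
theorem sum_smul_blocks {T B : QRep} (μ : Fin k → ℂ) (ξ : Fin k → ExtCochain T B) :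
    (∑ j, μ j • ξ j) = (∑ j, μ j • (ξ j).1, ∑ j, μ j • (ξ j).2.1, ∑ j, μ j • (ξ j).2.2.1,
      ∑ j, μ j • (ξ j).2.2.2.1, ∑ j, μ j • (ξ j).2.2.2.2) := by
  simp [Prod.ext_iff, Prod.fst_sum, Prod.snd_sum]

/-- If a submodule meeting `V` trivially maps onto a diagonal copy of `C`, the corresponding
combination of the extension classes vanishes. -/
theorem isECoboundary_of_tens_mem {C V E : QRep} (hCf : finrank ℂ C.Vf = 0)
    {ξ : Fin k → ExtCochain C V} {i : QHom V E} {p : QHom E (C.pow k)}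
    (h : RealizesExt i p (assembleRow ξ)) (S : QSub E) (hS : (S.comap i).IsBot)
    {μ : Fin k → ℂ} (h0 : ∀ c : C.V0, tens μ c ∈ (S.map p).S0)
    (h1 : ∀ c : C.V1, tens μ c ∈ (S.map p).S1) :
    IsECoboundary C V (∑ j, μ j • ξ j) := by
  obtain ⟨⟨hi0, hi1, -, -, -, -, e0, e1, -⟩, s0, s1, sf, ps0, ps1, -, x1, x2, x3, x4, -⟩ := h
  obtain ⟨r0, r0S, r0p⟩ := exists_lift_mem S.S0 p.g0 (tens (A := C.V0) μ) h0
  obtain ⟨r1, r1S, r1p⟩ := exists_lift_mem S.S1 p.g1 (tens (A := C.V1) μ) h1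
  have inj0 (x y) (hx : x ∈ S.S0) (hy : y ∈ S.S0) (hxy : p.g0 x = p.g0 y) : x = y := by
    obtain ⟨z, hz⟩ : x - y ∈ LinearMap.range i.g0 := by simp [e0, hxy]
    have hz0 : z = 0 := (Submodule.eq_bot_iff _).mp hS.1 z (hz ▸ S.S0.sub_mem hx hy :)
    rw [hz0, map_zero] at hz
    exact (sub_eq_zero.mp hz.symm)
  have inj1 (x y) (hx : x ∈ S.S1) (hy : y ∈ S.S1) (hxy : p.g1 x = p.g1 y) : x = y := by
    obtain ⟨z, hz⟩ : x - y ∈ LinearMap.range i.g1 := by simp [e1, hxy]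
    have hz0 : z = 0 := (Submodule.eq_bot_iff _).mp hS.2.1 z (hz ▸ S.S1.sub_mem hx hy :)
    rw [hz0, map_zero] at hz
    exact (sub_eq_zero.mp hz.symm)
  obtain ⟨η0, hη0⟩ := exists_factor e0 (s0 ∘ₗ tens (A := C.V0) μ - r0) fun c => by
    have := LinearMap.congr_fun ps0 (tens (A := C.V0) μ c)
    simp only [LinearMap.sub_apply, map_sub, r0p] at this ⊢
    exact sub_eq_zero.mpr this
  obtain ⟨η1, hη1⟩ := exists_factor e1 (s1 ∘ₗ tens (A := C.V1) μ - r1) fun c => by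
    have := LinearMap.congr_fun ps1 (tens (A := C.V1) μ c)
    simp only [LinearMap.sub_apply, map_sub, r1p] at this ⊢
    exact sub_eq_zero.mpr this
  have ca1 (x) : r1 (C.a1 x) = E.a1 (r0 x) := inj1 _ _ (r1S _) (S.ha1 _ (r0S _)) <| by
    have := LinearMap.congr_fun p.comm_a1 (r0 x)
    simp only [LinearMap.comp_apply, r0p] at this
    exact (r1p _).trans ((tens_map μ C.a1 x).symm.trans this.symm)
  have ca2 (x) : r1 (C.a2 x) = E.a2 (r0 x) := inj1 _ _ (r1S _) (S.ha2 _ (r0S _)) <| by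
    have := LinearMap.congr_fun p.comm_a2 (r0 x)
    simp only [LinearMap.comp_apply, r0p] at this
    exact (r1p _).trans ((tens_map μ C.a2 x).symm.trans this.symm)
  have cb1 (x) : r0 (C.b1 x) = E.b1 (r1 x) := inj0 _ _ (r0S _) (S.hb1 _ (r1S _)) <| by
    have := LinearMap.congr_fun p.comm_b1 (r1 x)
    simp only [LinearMap.comp_apply, r1p] at this
    exact (r0p _).trans ((tens_map μ C.b1 x).symm.trans this.symm)
  have cb2 (x) : r0 (C.b2 x) = E.b2 (r1 x) := inj0 _ _ (r0S _) (S.hb2 _ (r1S _)) <| by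
    have := LinearMap.congr_fun p.comm_b2 (r1 x)
    simp only [LinearMap.comp_apply, r1p] at this
    exact (r0p _).trans ((tens_map μ C.b2 x).symm.trans this.symm)
  rw [sum_smul_blocks]
  refine ⟨η0, η1, 0, ?_, ?_, ?_, ?_, ?_⟩
  · exact sum_smul_eq_of_row_splitting hi1 i.comm_a1 x1 ca1 hη0 hη1
  · exact sum_smul_eq_of_row_splitting hi1 i.comm_a2 x2 ca2 hη0 hη1
  · exact sum_smul_eq_of_row_splitting hi0 i.comm_b1 x3 cb1 hη1 hη0
  · exact sum_smul_eq_of_row_splitting hi0 i.comm_b2 x4 cb2 hη1 hη0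
  · have := finrank_zero_iff.mp hCf
    ext x
    simp [Subsingleton.elim x 0]

/-- If a submodule surjects onto `V` and meets `C^{⊕k}` in the kernel of a linear combination of
the coordinates, the corresponding combination of the extension classes vanishes. -/
theorem isECoboundary_of_lincomb_eq_zero {C V E : QRep}
    {ξ : Fin k → ExtCochain V C} {i : QHom (C.pow k) E} {p : QHom E V}
    (h : RealizesExt i p (assembleCol ξ)) (S : QSub E) (hS : (S.map p).IsTop)
    {μ : Fin k → ℂ} (h0 : ∀ x ∈ (S.comap i).S0, lincomb (A := C.V0) μ x = 0)
    (h1 : ∀ x ∈ (S.comap i).S1, lincomb (A := C.V1) μ x = 0) :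
    IsECoboundary V C (∑ j, μ j • ξ j) := by
  obtain ⟨⟨hi0, hi1, hif, -, -, -, e0, e1, ef⟩, s0, s1, sf, ps0, ps1, psf,
    x1, x2, x3, x4, x5⟩ := h
  obtain ⟨r0, r0S, r0p⟩ := exists_lift_mem S.S0 p.g0 LinearMap.id fun c => hS.1.ge trivial
  obtain ⟨r1, r1S, r1p⟩ := exists_lift_mem S.S1 p.g1 LinearMap.id fun c => hS.2.1.ge trivial
  obtain ⟨rf, rfS, rfp⟩ := exists_lift_mem S.Sf p.gf LinearMap.id fun c => hS.2.2.ge trivial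
  obtain ⟨t0, ht0⟩ := exists_factor e0 (s0 - r0) fun c => by
    have := LinearMap.congr_fun ps0 c
    simp only [LinearMap.comp_apply, LinearMap.sub_apply, map_sub, r0p] at this ⊢
    exact sub_eq_zero.mpr this
  obtain ⟨t1, ht1⟩ := exists_factor e1 (s1 - r1) fun c => by
    have := LinearMap.congr_fun ps1 c
    simp only [LinearMap.comp_apply, LinearMap.sub_apply, map_sub, r1p] at this ⊢
    exact sub_eq_zero.mpr this
  obtain ⟨tf, htf⟩ := exists_factor ef (sf - rf) fun c => by
    have := LinearMap.congr_fun psf c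
    simp only [LinearMap.comp_apply, LinearMap.sub_apply, map_sub, rfp] at this ⊢
    exact sub_eq_zero.mpr this
  have k0 (z) (hz : z ∈ S.S0) (hp : p.g0 z = 0) :
      ∃ y, i.g0 y = z ∧ lincomb (A := C.V0) μ y = 0 := by
    obtain ⟨y, rfl⟩ := e0.ge hp
    exact ⟨y, rfl, h0 y hz⟩
  have k1 (z) (hz : z ∈ S.S1) (hp : p.g1 z = 0) :
      ∃ y, i.g1 y = z ∧ lincomb (A := C.V1) μ y = 0 := by
    obtain ⟨y, rfl⟩ := e1.ge hp
    exact ⟨y, rfl, h1 y hz⟩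
  have ca1 (x) := k1 _ (S.S1.sub_mem (S.ha1 _ (r0S x)) (r1S (V.a1 x))) (by
    have := LinearMap.congr_fun p.comm_a1 (r0 x)
    simp only [LinearMap.comp_apply, r0p, LinearMap.id_apply] at this
    simp [this, r1p])
  have ca2 (x) := k1 _ (S.S1.sub_mem (S.ha2 _ (r0S x)) (r1S (V.a2 x))) (by
    have := LinearMap.congr_fun p.comm_a2 (r0 x)
    simp only [LinearMap.comp_apply, r0p, LinearMap.id_apply] at this
    simp [this, r1p])
  have cb1 (x) := k0 _ (S.S0.sub_mem (S.hb1 _ (r1S x)) (r0S (V.b1 x))) (by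
    have := LinearMap.congr_fun p.comm_b1 (r1 x)
    simp only [LinearMap.comp_apply, r1p, LinearMap.id_apply] at this
    simp [this, r0p])
  have cb2 (x) := k0 _ (S.S0.sub_mem (S.hb2 _ (r1S x)) (r0S (V.b2 x))) (by
    have := LinearMap.congr_fun p.comm_b2 (r1 x)
    simp only [LinearMap.comp_apply, r1p, LinearMap.id_apply] at this
    simp [this, r0p])
  have cw (x) := k0 _ (S.S0.sub_mem (S.hw _ (rfS x)) (r0S (V.w x))) (by
    have := LinearMap.congr_fun p.comm_w (rf x)
    simp only [LinearMap.comp_apply, rfp, LinearMap.id_apply] at this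
    simp [this, r0p])
  rw [sum_smul_blocks]
  refine ⟨lincomb (A := C.V0) μ ∘ₗ t0, lincomb (A := C.V1) μ ∘ₗ t1,
    lincomb (A := C.Vf) μ ∘ₗ tf, ?_, ?_, ?_, ?_, ?_⟩
  · exact sum_smul_eq_of_col_splitting hi1 i.comm_a1 x1 ht0 ht1 ca1
  · exact sum_smul_eq_of_col_splitting hi1 i.comm_a2 x2 ht0 ht1 ca2
  · exact sum_smul_eq_of_col_splitting hi0 i.comm_b1 x3 ht1 ht0 cb1
  · exact sum_smul_eq_of_col_splitting hi0 i.comm_b2 x4 ht1 ht0 cb2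
  · exact sum_smul_eq_of_col_splitting hi0 i.comm_w x5 htf ht0 cw

theorem IsExactSeq.dims {B E T : QRep} {i : QHom B E} {p : QHom E T} (h : IsExactSeq i p) :
    B.d0 + T.d0 = E.d0 ∧ B.d1 + T.d1 = E.d1 ∧ B.df + T.df = E.df := by
  obtain ⟨h0, h1, hf, s0, s1, sf, e0, e1, ef⟩ := h
  have r0 := (⊤ : Submodule ℂ E.V0).finrank_comap_add_map h0 e0
  have r1 := (⊤ : Submodule ℂ E.V1).finrank_comap_add_map h1 e1
  have rf := (⊤ : Submodule ℂ E.Vf).finrank_comap_add_map hf ef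
  rw [Submodule.comap_top, Submodule.map_top, LinearMap.range_eq_top.mpr s0] at r0
  rw [Submodule.comap_top, Submodule.map_top, LinearMap.range_eq_top.mpr s1] at r1
  rw [Submodule.comap_top, Submodule.map_top, LinearMap.range_eq_top.mpr sf] at rf
  simp only [finrank_top] at r0 r1 rf
  exact ⟨r0, r1, rf⟩

theorem QSub.isBot_iff_finrank {E : QRep} {S : QSub E} : S.IsBot ↔
    finrank ℂ S.S0 = 0 ∧ finrank ℂ S.S1 = 0 ∧ finrank ℂ S.Sf = 0 := by
  simp only [IsBot, Submodule.finrank_eq_zero]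

theorem QSub.isTop_iff_finrank {E : QRep} {S : QSub E} : S.IsTop ↔
    finrank ℂ S.S0 = E.d0 ∧ finrank ℂ S.S1 = E.d1 ∧ finrank ℂ S.Sf = E.df := by
  refine ⟨?_, fun ⟨h0, h1, hf⟩ => ⟨Submodule.eq_top_of_finrank_eq h0,
    Submodule.eq_top_of_finrank_eq h1, Submodule.eq_top_of_finrank_eq hf⟩⟩
  rintro ⟨h0, h1, hf⟩
  rw [h0, h1, hf]
  simp [QRep.d0, QRep.d1, QRep.df]

theorem QRep.slope_pow {C : QRep} {a b : ℝ} (h : a * C.d0 + b * C.d1 = 0) :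
    a * (C.pow k).d0 + b * (C.pow k).d1 = 0 := by
  have h0 : (C.pow k).d0 = k * C.d0 := by
    have : finrank ℂ (Fin k → C.V0) = k * finrank ℂ C.V0 := by
      rw [Module.finrank_pi_fintype]
      simp
    exact this
  have h1 : (C.pow k).d1 = k * C.d1 := by
    have : finrank ℂ (Fin k → C.V1) = k * finrank ℂ C.V1 := by
      rw [Module.finrank_pi_fintype]
      simp
    exact this
  rw [h0, h1]
  push_cast
  linear_combination (k : ℝ) * h

end Extensions


/-- **Nagao–Nakajima, Proposition 3.6.**
Let `ζ°` lie on a wall `L`, let `C` be the unique `θ_{ζ°}`-stable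
`A`-module with `ζ°·dim C = 0`, and let `ζ^± = ζ° ± (ε,ε)` for
sufficiently small `ε > 0` (the adjacent chambers).

(1) Let `Ṽ` be a `ζ°`-stable framed module and let a point of the
Grassmannian `Gr(k, Ext¹_Ã(C, Ṽ))` be given by `k` cocycles
`ξ 0, …, ξ (k−1)` whose classes in `Ext¹_Ã(C, Ṽ)` are linearly
independent.  Then the framed module `Ṽ'` given by the corresponding
universal extension `0 → Ṽ → Ṽ' → C^{⊕k} → 0` is `ζ^+`-stable.

(2) Dually, for a point of `Gr(k', Ext¹_Ã(Ṽ, C))` the module `Ṽ''` given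
by the universal extension `0 → C^{⊕k'} → Ṽ'' → Ṽ → 0` is `ζ^-`-stable. -/
theorem universal_extension_stability
    (ζ : ℝ × ℝ) (m : ℕ) (hwall : OnWall ζ m)
    (C : QRep) (hCf : Module.finrank ℂ C.Vf = 0) (hCne : 0 < C.d0 + C.d1)
    (hCst : IsStableUn ζ C)
    (hCslope : ζ.1 * (C.d0 : ℝ) + ζ.2 * (C.d1 : ℝ) = 0)
    (hCuniq : ∀ C' : QRep, Module.finrank ℂ C'.Vf = 0 → 0 < C'.d0 + C'.d1 →
      IsStableUn ζ C' → ζ.1 * (C'.d0 : ℝ) + ζ.2 * (C'.d1 : ℝ) = 0 → QIso C' C)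
    (V : QRep) (hVf : Module.finrank ℂ V.Vf = 1) (hVst : IsStableFr ζ V) :
    -- (1) universal extensions by quotients `C^{⊕k}` are `ζ⁺`-stable
    (∀ (k : ℕ) (ξ : Fin k → ExtCochain C V),
      (∀ j, IsECocycle C V (ξ j)) →
      (∀ c : Fin k → ℂ, IsECoboundary C V (∑ j, c j • ξ j) → c = 0) →
      ∀ (E : QRep) (i : QHom V E) (p : QHom E (C.pow k)),
        RealizesExt i p (assembleRow ξ) →
        ∃ ε₀ > (0 : ℝ), ∀ ε : ℝ, 0 < ε → ε < ε₀ →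
          IsStableFr (ζ.1 + ε, ζ.2 + ε) E) ∧
    -- (2) universal extensions by subobjects `C^{⊕k}` are `ζ⁻`-stable
    (∀ (k : ℕ) (ξ : Fin k → ExtCochain V C),
      (∀ j, IsECocycle V C (ξ j)) →
      (∀ c : Fin k → ℂ, IsECoboundary V C (∑ j, c j • ξ j) → c = 0) →
      ∀ (E : QRep) (i : QHom (C.pow k) E) (p : QHom E V),
        RealizesExt i p (assembleCol ξ) →
        ∃ ε₀ > (0 : ℝ), ∀ ε : ℝ, 0 < ε → ε < ε₀ →
          IsStableFr (ζ.1 - ε, ζ.2 - ε) E) := by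
  have hC : ∀ S : QSub C, S.IsBot ∨ S.IsTop ∨ S.wt ζ.1 ζ.2 0 < 0 := fun S => by
    have := (isStableQ_iff (by simpa using hCslope)).mp hCst S
    tauto
  have hV : ∀ S : QSub V, S.IsBot ∨ S.IsTop ∨
      S.wt ζ.1 ζ.2 (-(ζ.1 * V.d0 + ζ.2 * V.d1)) < 0 := fun S => by
    have := (isStableFr_iff hVf).mp hVst S
    tauto
  have hpow (k : ℕ) := C.finrank_pow_Vf (k := k) hCf
  constructor
  · intro k ξ _ hind E i p hE
    have hex := hE.1
    obtain ⟨dim0, dim1, dimf⟩ := hex.dims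
    have hdf : E.df = 1 := by rw [← dimf, QRep.df, QRep.df, hVf, hpow k]
    have hwE : ζ.1 * (E.d0 : ℝ) + ζ.2 * E.d1 = ζ.1 * V.d0 + ζ.2 * V.d1 := by
      rw [← dim0, ← dim1]
      push_cast
      linear_combination QRep.slope_pow (k := k) hCslope
    have main := isStableFr_perturb (ζ := ζ) hdf 1 fun S hb ht => by
      rw [hwE]
      have hsum := S.wt_comap_add_map ζ.1 ζ.2 (-(ζ.1 * V.d0 + ζ.2 * V.d1)) hex
      rw [(S.map p).wt_eq_of_Vf (hpow k)] at hsum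
      have hq := QSub.wt_pow_nonpos hCf hC hCslope (S.map p)
      obtain ⟨f0, f1, ff⟩ := hex.finrank_sub S
      rcases hV (S.comap i) with h | h | h
      · have hz := h.wt_eq_zero ζ.1 ζ.2 (-(ζ.1 * V.d0 + ζ.2 * V.d1))
        rcases hq.lt_or_eq with hlt | heq
        · left
          linarith
        · have hnb : ¬ (S.map p).IsBot := fun hc => hb <| by
            rw [QSub.isBot_iff_finrank] at h hc ⊢
            omega
          obtain ⟨μ, hμ, m0, m1⟩ := QSub.exists_tens_mem hCf hC hCslope _ hnb heq
          exact absurd (hind μ (isECoboundary_of_tens_mem hCf hE S h m0 m1)) hμ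
      · have hz : (S.comap i).wt ζ.1 ζ.2 (-(ζ.1 * V.d0 + ζ.2 * V.d1)) = 0 := by
          rw [h.wt_eq, QRep.df, hVf]
          simp
        rcases hq.lt_or_eq with hlt | heq
        · left
          linarith
        · refine Or.inr ⟨by linarith, ?_⟩
          have l0 : finrank ℂ S.S0 ≤ E.d0 := S.S0.finrank_le
          have l1 : finrank ℂ S.S1 ≤ E.d1 := S.S1.finrank_le
          have lf : finrank ℂ S.Sf ≤ E.df := S.Sf.finrank_le
          have hcf := (QSub.isTop_iff_finrank.mp h).2.2
          have hSf : finrank ℂ S.Sf = 1 := by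
            rw [QRep.df, hVf] at hcf
            omega
          have hlt : finrank ℂ S.S0 + finrank ℂ S.S1 < E.d0 + E.d1 := by
            by_contra hc
            exact ht (QSub.isTop_iff_finrank.mpr ⟨by omega, by omega, by omega⟩)
          have hlt' : (finrank ℂ S.S0 + finrank ℂ S.S1 : ℝ) < E.d0 + E.d1 := by
            exact_mod_cast hlt
          simp only [QSub.wt, hSf]
          push_cast
          linarith
      · left
        linarith
    simpa using main
  · intro k ξ _ hind E i p hE
    have hex := hE.1
    obtain ⟨dim0, dim1, dimf⟩ := hex.dims
    have hdf : E.df = 1 := by rw [← dimf, QRep.df, QRep.df, hVf, hpow k]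
    have hwE : ζ.1 * (E.d0 : ℝ) + ζ.2 * E.d1 = ζ.1 * V.d0 + ζ.2 * V.d1 := by
      rw [← dim0, ← dim1]
      push_cast
      linear_combination QRep.slope_pow (k := k) hCslope
    have main := isStableFr_perturb (ζ := ζ) hdf (-1) fun S hb ht => by
      rw [hwE]
      have hsum := S.wt_comap_add_map ζ.1 ζ.2 (-(ζ.1 * V.d0 + ζ.2 * V.d1)) hex
      rw [(S.comap i).wt_eq_of_Vf (hpow k)] at hsum
      have hq := QSub.wt_pow_nonpos hCf hC hCslope (S.comap i)
      obtain ⟨f0, f1, ff⟩ := hex.finrank_sub S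
      rcases hV (S.map p) with h | h | h
      · have hz := h.wt_eq_zero ζ.1 ζ.2 (-(ζ.1 * V.d0 + ζ.2 * V.d1))
        rcases hq.lt_or_eq with hlt | heq
        · left
          linarith
        · refine Or.inr ⟨by linarith, ?_⟩
          have hSf : finrank ℂ S.Sf = 0 := by
            rw [← ff, (QSub.isBot_iff_finrank.mp h).2.2, (S.comap i).Sf_eq_bot (hpow k)]
            simp
          have hpos : 0 < finrank ℂ S.S0 + finrank ℂ S.S1 := by
            have := QSub.finrank_pos_of_not_isBot hb
            omega
          have hpos' : (0 : ℝ) < finrank ℂ S.S0 + finrank ℂ S.S1 := by exact_mod_cast hpos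
          simp only [QSub.wt, hSf]
          push_cast
          linarith
      · have hz : (S.map p).wt ζ.1 ζ.2 (-(ζ.1 * V.d0 + ζ.2 * V.d1)) = 0 := by
          rw [h.wt_eq, QRep.df, hVf]
          simp
        rcases hq.lt_or_eq with hlt | heq
        · left
          linarith
        · have hnt : ¬ (S.comap i).IsTop := fun hc => ht <| by
            rw [QSub.isTop_iff_finrank] at h hc ⊢
            omega
          obtain ⟨μ, hμ, m0, m1⟩ :=
            QSub.exists_lincomb_eq_zero hCf hCne hC hCslope _ hnt heq
          exact absurd (hind μ (isECoboundary_of_lincomb_eq_zero hE S h m0 m1)) hμ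
      · left
        linarith
    simpa [sub_eq_add_neg] using main
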